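/- Let Φ be a CNF formula with variables x_1,…,x_s (s ≥ 1) and clauses c_1,…,c_t. For every rainbow tree T in the edge-colored graph G_Φ, there exists a truth assignment of the variables x_1,…,x_s that satisfies at least |V(T)| − 2s clauses of Φ. -/

import Mathlib

/-!
Edge-colored graph `G_Φ` associated with a CNF formula `Φ` with variables
`x_1, …, x_s` and clauses `c_1, …, c_t`.  Variables are indexed by `0, …, s-1`
and clauses by `0, …, t-1`.  The formula is given by two occurrence relations
`pos` and `neg`: `pos j i` means the positive literal `x_i` occurs in clause
`c_j`, and `neg j i` means the negative literal `¬x_i` occurs in clause `c_j`.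
-/

namespace Stmt1

/-- Vertices of `G_Φ`: `y i`, `a1 i`, `a2 i` for each variable index `i`,
and `cl j` for each clause index `j`. -/
inductive Vtx where
  | y (i : ℕ)
  | a1 (i : ℕ)
  | a2 (i : ℕ)
  | cl (j : ℕ)
deriving DecidableEq

/-- Colors: `b i` and `d i` for variable indices, `C j` for clause indices.
Distinct constructors/indices give pairwise distinct colors. -/
inductive Col where
  | b (i : ℕ)
  | C (j : ℕ)
  | d (i : ℕ)
deriving DecidableEq

/-- The set of edges of `G_Φ` receiving a given color. -/
def colorClass (s t : ℕ) (pos neg : ℕ → ℕ → Prop) : Col → Set (Sym2 Vtx)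
  | .b i => {e | i < s ∧ (e = s(Vtx.y i, Vtx.a1 i) ∨ e = s(Vtx.y i, Vtx.a2 i))}
  | .d i => {e | i + 1 < s ∧ e = s(Vtx.y i, Vtx.y (i + 1))}
  | .C j => {e | j < t ∧ ∃ i < s,
      (pos j i ∧ e = s(Vtx.cl j, Vtx.a1 i)) ∨ (neg j i ∧ e = s(Vtx.cl j, Vtx.a2 i))}

/-- The graph `G_Φ`. -/
def GPhi (s t : ℕ) (pos neg : ℕ → ℕ → Prop) : SimpleGraph Vtx :=
  SimpleGraph.fromEdgeSet (⋃ col, colorClass s t pos neg col)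

/-- A set of edges is rainbow if it contains at most one edge of each color. -/
def Rainbow (s t : ℕ) (pos neg : ℕ → ℕ → Prop) (E : Set (Sym2 Vtx)) : Prop :=
  ∀ col : Col, ∀ e ∈ E, ∀ f ∈ E,
    e ∈ colorClass s t pos neg col → f ∈ colorClass s t pos neg col → e = f

/-- The truth assignment `α` satisfies clause `c_j`. -/
def SatClause (s : ℕ) (pos neg : ℕ → ℕ → Prop) (α : ℕ → Bool) (j : ℕ) : Prop :=
  ∃ i < s, (pos j i ∧ α i = true) ∨ (neg j i ∧ α i = false)
/-- Adjacency in `G_Φ` means that the edge lies in some color class. -/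
theorem exists_mem_colorClass_of_adj {s t : ℕ} {pos neg : ℕ → ℕ → Prop} {u v : Vtx}
    (h : (GPhi s t pos neg).Adj u v) : ∃ c, s(u, v) ∈ colorClass s t pos neg c := by
  simpa using (SimpleGraph.fromEdgeSet_adj _ |>.mp h).1

theorem clause_adj_mem_colorClass {s t : ℕ} {pos neg : ℕ → ℕ → Prop} {j : ℕ} {v : Vtx}
    (h : (GPhi s t pos neg).Adj (.cl j) v) :
    s(Vtx.cl j, v) ∈ colorClass s t pos neg (.C j) := by
  obtain ⟨c, hc⟩ := exists_mem_colorClass_of_adj h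
  cases c <;> simp [colorClass] at hc ⊢
  grind

/-- A clause vertex has at most one neighbor in a rainbow subgraph. -/
theorem Rainbow.clause_adj_unique {s t : ℕ} {pos neg : ℕ → ℕ → Prop}
    {T : (GPhi s t pos neg).Subgraph} (hrb : Rainbow s t pos neg T.edgeSet) {j : ℕ} {u v : Vtx}
    (hu : T.Adj (.cl j) u) (hv : T.Adj (.cl j) v) : u = v := by
  have := hrb (.C j) _ (T.mem_edgeSet.mpr hu) _ (T.mem_edgeSet.mpr hv)
    (clause_adj_mem_colorClass hu.adj_sub) (clause_adj_mem_colorClass hv.adj_sub)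
  exact Sym2.congr_right.mp this

theorem adj_a1_cases {s t : ℕ} {pos neg : ℕ → ℕ → Prop} {i : ℕ} {v : Vtx}
    (h : (GPhi s t pos neg).Adj (.a1 i) v) : v = .y i ∨ ∃ j, v = .cl j := by
  obtain ⟨c, hc⟩ := exists_mem_colorClass_of_adj h
  cases c <;> simp [colorClass] at hc <;> grind

theorem adj_a2_cases {s t : ℕ} {pos neg : ℕ → ℕ → Prop} {i : ℕ} {v : Vtx}
    (h : (GPhi s t pos neg).Adj (.a2 i) v) : v = .y i ∨ ∃ j, v = .cl j := by
  obtain ⟨c, hc⟩ := exists_mem_colorClass_of_adj h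
  cases c <;> simp [colorClass] at hc <;> grind

/-- A set of vertices closed under adjacency in a connected subgraph contains every vertex as soon
as it contains one. -/
theorem mem_of_closed_of_connected {V : Type*} {G : SimpleGraph V} {T : G.Subgraph}
    (hT : T.coe.Connected) {S : Set V} (hS : ∀ u v, u ∈ S → T.Adj u v → v ∈ S)
    {u v : V} (hu : u ∈ T.verts) (hv : v ∈ T.verts) (huS : u ∈ S) : v ∈ S := by
  obtain ⟨p⟩ := hT.preconnected ⟨u, hu⟩ ⟨v, hv⟩
  have key : ∀ {x y : T.verts}, T.coe.Walk x y → (x : V) ∈ S → (y : V) ∈ S := by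
    intro x y p
    induction p with
    | nil => exact id
    | cons h _ ih => exact fun hx => ih (hS _ _ hx h)
  exact key p huS

/-- In a connected rainbow subgraph, a vertex whose only neighbors in `G_Φ` are `y i` and clause
vertices is adjacent to `y i`, if the subgraph contains another vertex that is not a clause. -/
theorem Rainbow.adj_y_of_connected {s t : ℕ} {pos neg : ℕ → ℕ → Prop}
    {T : (GPhi s t pos neg).Subgraph} (hrb : Rainbow s t pos neg T.edgeSet)
    (hT : T.coe.Connected) {i : ℕ} {a w : Vtx}
    (ha : ∀ v, (GPhi s t pos neg).Adj a v → v = .y i ∨ ∃ j, v = .cl j)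
    (haT : a ∈ T.verts) (hwT : w ∈ T.verts) (hwa : w ≠ a) (hw : ∀ j, w ≠ .cl j) :
    T.Adj a (.y i) := by
  by_contra hy
  have hwS : w ∈ {v | v = a ∨ ∃ j, v = .cl j ∧ T.Adj (.cl j) a} := by
    refine mem_of_closed_of_connected hT ?_ haT hwT (Or.inl rfl)
    rintro u v (rfl | ⟨j, rfl, hj⟩) huv
    · rcases ha v huv.adj_sub with rfl | ⟨j, rfl⟩
      · exact absurd huv hy
      · exact Or.inr ⟨j, rfl, huv.symm⟩
    · exact Or.inl (hrb.clause_adj_unique huv hj)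
  rcases hwS with h | ⟨j, h, -⟩
  · exact hwa h
  · exact hw j h

/-- A connected rainbow subgraph does not contain both literal vertices of a variable. -/
theorem Rainbow.not_mem_a1_and_a2 {s t : ℕ} {pos neg : ℕ → ℕ → Prop}
    {T : (GPhi s t pos neg).Subgraph} (hrb : Rainbow s t pos neg T.edgeSet)
    (hT : T.coe.Connected) {i : ℕ} (h1 : Vtx.a1 i ∈ T.verts) (h2 : Vtx.a2 i ∈ T.verts) :
    False := by
  have hy1 := (hrb.adj_y_of_connected hT (fun _ => adj_a1_cases) h1 h2 (by simp) (by simp)).symm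
  have hy2 := (hrb.adj_y_of_connected hT (fun _ => adj_a2_cases) h2 h1 (by simp) (by simp)).symm
  have hi : i < s := by
    obtain ⟨c, hc⟩ := exists_mem_colorClass_of_adj hy1.adj_sub
    cases c <;> simp [colorClass] at hc
    grind
  have := hrb (.b i) _ (T.mem_edgeSet.mpr hy1) _ (T.mem_edgeSet.mpr hy2)
    ⟨hi, Or.inl rfl⟩ ⟨hi, Or.inr rfl⟩
  simp at this

/-- A connected rainbow subgraph has at most `2 * s` vertices more than it has clause colors. -/
theorem Rainbow.ncard_verts_le {s t : ℕ} (hs : 1 ≤ s) {pos neg : ℕ → ℕ → Prop}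
    {T : (GPhi s t pos neg).Subgraph} (hrb : Rainbow s t pos neg T.edgeSet)
    (hT : T.coe.Connected) :
    T.verts.ncard ≤ 2 * s + {j | ∃ e ∈ T.edgeSet, e ∈ colorClass s t pos neg (.C j)}.ncard := by
  set J := {j | ∃ e ∈ T.edgeSet, e ∈ colorClass s t pos neg (.C j)}
  have hJfin : J.Finite := (Set.finite_lt_nat t).subset fun j ⟨_, _, he⟩ => he.1
  have hcol : ∀ e : T.coe.edgeSet, ∃ c, e.1.map Subtype.val ∈ colorClass s t pos neg c ∧
      e.1.map Subtype.val ∈ T.edgeSet := by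
    rintro ⟨e, he⟩
    induction e with
    | _ u v =>
      obtain ⟨c, hc⟩ := exists_mem_colorClass_of_adj (T.adj_sub he)
      exact ⟨c, hc, he⟩
  choose col hcol hedge using hcol
  have hinj : Function.Injective col := fun e f hef =>
    Subtype.ext (Sym2.map.injective Subtype.val_injective
      (hrb (col e) _ (hedge e) _ (hedge f) (hcol e) (hef ▸ hcol f)))
  let K : Finset Col := (Finset.range s).image .b ∪ (Finset.range (s - 1)).image .d ∪
    hJfin.toFinset.image .C
  have hK : ∀ e, col e ∈ K := by
    intro e
    have h1 := hcol e
    have h2 := hedge e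
    generalize hc : col e = c at h1
    cases c with
    | b i => simp [K, h1.1]
    | d i => have := h1.1; simp [K]; omega
    | C j =>
      exact Finset.mem_union_right _ (Finset.mem_image_of_mem Col.C
        (hJfin.mem_toFinset.mpr ⟨_, h2, h1⟩))
  have hKcard : K.card ≤ s + (s - 1) + J.ncard := by
    rw [Set.ncard_eq_toFinset_card J hJfin]
    refine (Finset.card_union_le _ _).trans (Nat.add_le_add
      ((Finset.card_union_le _ _).trans (Nat.add_le_add ?_ ?_)) Finset.card_image_le)
    · exact Finset.card_image_le.trans (by simp)
    · exact Finset.card_image_le.trans (by simp)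
  have hEK : Nat.card T.coe.edgeSet ≤ K.card := by
    simpa using Nat.card_le_card_of_injective (fun e => (⟨col e, hK e⟩ : K))
      (fun e f h => hinj (congrArg Subtype.val h))
  have hVE : T.verts.ncard ≤ Nat.card T.coe.edgeSet + 1 :=
    hT.card_vert_le_card_edgeSet_add_one
  omega

/-- For every rainbow tree `T` in `G_Φ`, some truth assignment of the variables
satisfies at least `|V(T)| - 2s` clauses of `Φ`. -/
theorem assignment_of_rainbow_tree (s t : ℕ) (hs : 1 ≤ s) (pos neg : ℕ → ℕ → Prop)
    (T : (GPhi s t pos neg).Subgraph)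
    (hT : T.coe.IsTree) (hrb : Rainbow s t pos neg T.edgeSet) :
    ∃ α : ℕ → Bool,
      T.verts.ncard - 2 * s ≤ {j | j < t ∧ SatClause s pos neg α j}.ncard := by
  classical
  let α : ℕ → Bool := fun i => decide (Vtx.a1 i ∈ T.verts)
  refine ⟨α, ?_⟩
  have hcount := hrb.ncard_verts_le hs hT.1
  have hsub : {j | ∃ e ∈ T.edgeSet, e ∈ colorClass s t pos neg (.C j)} ⊆
      {j | j < t ∧ SatClause s pos neg α j} := by
    rintro j ⟨e, heT, hjt, i, hi, ⟨hp, rfl⟩ | ⟨hn, rfl⟩⟩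
    · exact ⟨hjt, i, hi, Or.inl ⟨hp, decide_eq_true (T.edge_vert (T.mem_edgeSet.mp heT).symm)⟩⟩
    · exact ⟨hjt, i, hi, Or.inr ⟨hn, decide_eq_false fun h1 =>
        hrb.not_mem_a1_and_a2 hT.1 h1 (T.edge_vert (T.mem_edgeSet.mp heT).symm)⟩⟩
  have := Set.ncard_le_ncard hsub ((Set.finite_lt_nat t).subset fun j hj => hj.1)
  omega

end Stmt1
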